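/- arXiv:2110.10730 — 6 statements merged into one kernel-verified Lean document; each statement's English description precedes it below -/
import Mathlib

section
/- Let n be a positive integer. There exists a polynomial pₙ : ℂ → ℂ of degree at most n−1 such that 2s·pₙ(s) = (1+s)ⁿ·(1 − Tₙ((1−s)/(1+s))) for all s ∈ ℂ with s ≠ −1, where Tₙ denotes the n-th Chebyshev polynomial of the first kind. -/
open Polynomial

/-- Substituting `(1 - s) / (1 + s)` into a polynomial of degree at most `m` and multiplying by
`(1 + s) ^ m` gives a polynomial in `s` of degree at most `m`. -/
theorem exists_natDegree_le_eval_eq_pow_mul_eval_div {K : Type*} [Field K] (q : K[X]) (m : ℕ)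
    (hq : q.natDegree ≤ m) :
    ∃ r : K[X], r.natDegree ≤ m ∧ ∀ s : K, s ≠ -1 →
      r.eval s = (1 + s) ^ m * q.eval ((1 - s) / (1 + s)) := by
  refine ⟨∑ i ∈ Finset.range (m + 1), C (q.coeff i) * ((1 - X) ^ i * (1 + X) ^ (m - i)), ?_, ?_⟩
  · refine natDegree_sum_le_of_forall_le _ _ fun i hi => ?_
    have him : i ≤ m := Finset.mem_range_succ_iff.mp hi
    have hsub : ((1 : K[X]) - X).natDegree ≤ 1 := by compute_degree
    have hadd : ((1 : K[X]) + X).natDegree ≤ 1 := by compute_degree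
    calc (C (q.coeff i) * ((1 - X) ^ i * (1 + X) ^ (m - i))).natDegree
        ≤ ((1 - X : K[X]) ^ i * (1 + X) ^ (m - i)).natDegree := natDegree_C_mul_le _ _
      _ ≤ i * 1 + (m - i) * 1 :=
          natDegree_mul_le_of_le (natDegree_pow_le_of_le i hsub)
            (natDegree_pow_le_of_le (m - i) hadd)
      _ = m := by omega
  · intro s hs
    have hs' : 1 + s ≠ 0 := fun h => hs (eq_neg_of_add_eq_zero_right h)
    rw [eval_eq_sum_range' (Nat.lt_succ_of_le hq), eval_finsetSum, Finset.mul_sum]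
    refine Finset.sum_congr rfl fun i hi => ?_
    have him : i ≤ m := Finset.mem_range_succ_iff.mp hi
    simp only [eval_mul, eval_C, eval_pow, eval_sub, eval_add, eval_one, eval_X]
    rw [div_pow, ← pow_sub_mul_pow (1 + s) him]
    field_simp

/-- Existence of the extremal polynomial `pₙ`: there is a polynomial of degree at most
`n - 1` with `2 s pₙ(s) = (1+s)^n (1 - Tₙ((1-s)/(1+s)))` for all `s ≠ -1`. -/
theorem exists_extremal_polynomial (n : ℕ) (hn : 0 < n) :
    ∃ p : Polynomial ℂ, p.natDegree ≤ n - 1 ∧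
      ∀ s : ℂ, s ≠ -1 →
        2 * s * p.eval s =
          (1 + s) ^ n * (1 - (Polynomial.Chebyshev.T ℂ (n : ℤ)).eval ((1 - s) / (1 + s))) := by
  set T := Chebyshev.T ℂ (n : ℤ)
  have hroot : (T - 1).IsRoot 1 := by simp [T]
  have hfactor : (X - C 1) * ((T - 1) /ₘ (X - C 1)) = T - 1 :=
    mul_divByMonic_eq_iff_isRoot.mpr hroot
  have hT : T.natDegree ≤ n := by simp [T]
  have hdeg : ((T - 1) /ₘ (X - C 1)).natDegree ≤ n - 1 := by
    rw [natDegree_divByMonic _ (monic_X_sub_C 1), natDegree_X_sub_C]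
    exact Nat.sub_le_sub_right
      ((natDegree_sub_le_of_le hT (natDegree_one.trans_le n.zero_le)).trans (max_self n).le) 1
  obtain ⟨p, hp, heval⟩ := exists_natDegree_le_eval_eq_pow_mul_eval_div _ _ hdeg
  refine ⟨p, hp, fun s hs => ?_⟩
  have hs' : 1 + s ≠ 0 := fun h => hs (eq_neg_of_add_eq_zero_right h)
  have hvalue := congrArg (eval ((1 - s) / (1 + s))) hfactor
  simp only [eval_mul, eval_sub, eval_X, eval_C, eval_one] at hvalue
  rw [heval s hs, ← neg_sub (T.eval _) 1, ← hvalue, ← pow_sub_mul_pow (1 + s) hn]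
  field_simp
  ring
end

section
/- Let n be a positive integer and let pₙ : ℂ → ℂ be the polynomial determined by 2s·pₙ(s) = (1+s)ⁿ·(1 − Tₙ((1−s)/(1+s))) for s ≠ −1. Then pₙ(s) is real and pₙ(s) ≥ 0 for all real s ≥ 0, and pₙ(s) ≤ s⁻¹·(1+s)ⁿ for all real s > 0. -/
open Polynomial

/-- At a positive real `s`, the value of the extremal polynomial is the real number
`s⁻¹ (1+s)^n (1 - Tₙ((1-s)/(1+s))) / 2`. -/
theorem extremal_polynomial_eval_ofReal {n : ℕ} {p : Polynomial ℂ}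
    (hp : ∀ s : ℂ, s ≠ -1 →
      2 * s * p.eval s =
        (1 + s) ^ n * (1 - (Polynomial.Chebyshev.T ℂ (n : ℤ)).eval ((1 - s) / (1 + s))))
    {s : ℝ} (hs : 0 < s) :
    p.eval (s : ℂ) = ((s⁻¹ * (1 + s) ^ n *
      ((1 - (Polynomial.Chebyshev.T ℝ (n : ℤ)).eval ((1 - s) / (1 + s))) / 2) : ℝ) : ℂ) := by
  have hs_ne : (s : ℂ) ≠ -1 := by
    intro h
    have : s = -1 := by exact_mod_cast h
    linarith
  have hs_zero : (s : ℂ) ≠ 0 := by exact_mod_cast hs.ne'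
  have h := hp s hs_ne
  have hT := Polynomial.Chebyshev.complex_ofReal_eval_T ((1 - s) / (1 + s)) (n : ℤ)
  push_cast at hT ⊢
  rw [← hT] at h
  field_simp
  linear_combination h

theorem abs_one_sub_div_one_add_le_one {s : ℝ} (hs : 0 ≤ s) : |(1 - s) / (1 + s)| ≤ 1 := by
  rw [abs_le, le_div_iff₀ (by linarith), div_le_iff₀ (by linarith)]
  constructor <;> linarith

/-- The extremal polynomial `pₙ` is real and nonnegative on the nonnegative real axis
and satisfies the growth condition `pₙ(s) ≤ s⁻¹ (1+s)^n` for real `s > 0`. -/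
theorem extremal_polynomial_nonneg_and_growth (n : ℕ) (hn : 0 < n) (p : Polynomial ℂ)
    (hp : ∀ s : ℂ, s ≠ -1 →
      2 * s * p.eval s =
        (1 + s) ^ n * (1 - (Polynomial.Chebyshev.T ℂ (n : ℤ)).eval ((1 - s) / (1 + s)))) :
    (∀ s : ℝ, 0 ≤ s → (p.eval (s : ℂ)).im = 0 ∧ 0 ≤ (p.eval (s : ℂ)).re) ∧
    (∀ s : ℝ, 0 < s → (p.eval (s : ℂ)).re ≤ s⁻¹ * (1 + s) ^ n) := by
  have hT (s : ℝ) (hs : 0 < s) := abs_le.mp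
    (Polynomial.Chebyshev.abs_eval_T_real_le_one (n : ℤ) (abs_one_sub_div_one_add_le_one hs.le))
  have hpos : ∀ s ∈ Set.Ioi (0 : ℝ),
      p.eval (s : ℂ) ∈ {z : ℂ | z.im = 0 ∧ 0 ≤ z.re} := by
    intro s hs
    have hs' : 0 < s := hs
    rw [extremal_polynomial_eval_ofReal hp hs']
    refine ⟨Complex.ofReal_im _, ?_⟩
    rw [Complex.ofReal_re]
    exact mul_nonneg (by positivity) (by linarith [(hT s hs').2])
  have hclosed : IsClosed {z : ℂ | z.im = 0 ∧ 0 ≤ z.re} :=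
    (isClosed_eq Complex.continuous_im continuous_const).inter
      (isClosed_le continuous_const Complex.continuous_re)
  refine ⟨fun s hs => ?_, fun s hs => ?_⟩
  · have hcont : Continuous fun t : ℝ => p.eval (t : ℂ) :=
      p.continuous.comp Complex.continuous_ofReal
    have hmem : s ∈ closure (Set.Ioi (0 : ℝ)) := by rwa [closure_Ioi]
    exact closure_minimal hpos (hclosed.preimage hcont) hmem
  · rw [extremal_polynomial_eval_ofReal hp hs, Complex.ofReal_re]
    exact mul_le_of_le_one_right (by positivity) (by linarith [(hT s hs).1])
end

section
/- Let n be a positive integer and let q : ℂ → ℂ be a polynomial of degree at most n with q(0) = 0. Define, for z ∈ ℂ with z ≠ 0 and z ≠ −1, f(z) := ((1+z)^(2n)/(4z)ⁿ)·q(−((1−z)/(1+z))²). Then f is twice differentiable at z = 1 and q'(0) = −2·f''(1). -/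
open Polynomial

/-- The second derivative at `a` of `(z - a)² g(z)` is `2 g(a)` when `g` is analytic at `a`. -/
lemma deriv_deriv_eq_of_eventuallyEq_sub_sq_mul {f g : ℂ → ℂ} {a : ℂ} (hg : AnalyticAt ℂ g a)
    (hfg : f =ᶠ[nhds a] fun z => (z - a) ^ 2 * g z) :
    deriv (deriv f) a = 2 * g a := by
  have hderiv : deriv f =ᶠ[nhds a]
      fun z => 2 * (z - a) * g z + (z - a) ^ 2 * deriv g z := by
    refine hfg.deriv.trans ?_
    filter_upwards [hg.eventually_analyticAt] with z hz
    have h := (((hasDerivAt_id z).sub_const a).pow 2).mul hz.differentiableAt.hasDerivAt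
    exact h.deriv.trans (by simp)
  rw [hderiv.deriv_eq]
  have hlin : HasDerivAt (fun z : ℂ => z - a) 1 a := (hasDerivAt_id a).sub_const a
  have h := ((hlin.const_mul 2).mul hg.differentiableAt.hasDerivAt).add
    ((hlin.pow 2).mul hg.deriv.differentiableAt.hasDerivAt)
  exact h.deriv.trans (by simp)

/-- For a polynomial `q` of degree at most `n` with `q(0) = 0`, the auxiliary function
`f(z) = ((1+z)^(2n)/(4z)^n) q(-((1-z)/(1+z))²)` is twice differentiable at `z = 1` and
`q'(0) = -2 f''(1)`. -/
theorem deriv_at_zero_eq_neg_two_second_deriv (n : ℕ) (hn : 0 < n) (q : Polynomial ℂ)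
    (hdeg : q.natDegree ≤ n) (h0 : q.eval 0 = 0)
    (f : ℂ → ℂ)
    (hf : ∀ z : ℂ, z ≠ 0 → z ≠ -1 →
      f z = (1 + z) ^ (2 * n) / (4 * z) ^ n * q.eval (-((1 - z) / (1 + z)) ^ 2)) :
    DifferentiableAt ℂ f 1 ∧ DifferentiableAt ℂ (deriv f) 1 ∧
      (Polynomial.derivative q).eval 0 = -2 * deriv (deriv f) 1 := by
  obtain ⟨r, rfl⟩ : X ∣ q := by rwa [X_dvd_iff, coeff_zero_eq_eval_zero]
  set g : ℂ → ℂ := fun z => (1 + z) ^ (2 * n) / (4 * z) ^ n *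
    (-(1 / (1 + z)) ^ 2 * r.eval (-((1 - z) / (1 + z)) ^ 2)) with hg_def
  have hadd : AnalyticAt ℂ (fun z : ℂ => 1 + z) 1 := analyticAt_const.add analyticAt_id
  have hquot : AnalyticAt ℂ (fun z : ℂ => -((1 - z) / (1 + z)) ^ 2) 1 :=
    (((analyticAt_const.sub analyticAt_id).div hadd (by norm_num)).pow 2).neg
  have hg : AnalyticAt ℂ g 1 :=
    ((hadd.pow _).div ((analyticAt_const.mul analyticAt_id).pow _) (by simp)).mul
      (((analyticAt_const.div hadd (by norm_num)).pow 2).neg.mul (hquot.aeval_polynomial r))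
  have hfg : f =ᶠ[nhds 1] fun z => (z - 1) ^ 2 * g z := by
    filter_upwards [isOpen_ne.mem_nhds (one_ne_zero : (1 : ℂ) ≠ 0),
      isOpen_ne.mem_nhds (by norm_num : (1 : ℂ) ≠ -1)] with z hz hz'
    rw [hf z hz hz', eval_mul, eval_X, hg_def]
    ring
  have hfan : AnalyticAt ℂ f 1 :=
    (((analyticAt_id.sub analyticAt_const).pow 2).mul hg).congr hfg.symm
  refine ⟨hfan.differentiableAt, hfan.deriv.differentiableAt, ?_⟩
  have hg_one : g 1 = -(1 / 4) * r.eval 0 := by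
    have hpow : ((1 : ℂ) + 1) ^ (2 * n) = 4 ^ n := by rw [pow_mul]; norm_num
    simp only [hg_def, hpow]
    norm_num
  rw [deriv_deriv_eq_of_eventuallyEq_sub_sq_mul hg hfg, hg_one]
  simp only [derivative_mul, derivative_X, one_mul, eval_add, eval_mul, eval_X, zero_mul, add_zero]
  ring
end

section
/- Let n be a positive integer and let q : ℂ → ℂ be a polynomial of degree at most n with q(0) = 0. Define, for z ≠ −1, g(z) := ((1+z)^(2n)/4ⁿ)·q(−((1−z)/(1+z))²). Then g'(1) = 0 and q'(0) = −2·g''(1). -/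
open Polynomial

/-- If `h` is differentiable at `a`, the derivative of `z ↦ (z - a) * h z` at `a` is `h a`. -/
lemma deriv_sub_mul_self {h : ℂ → ℂ} {a : ℂ} (hh : DifferentiableAt ℂ h a) :
    deriv (fun z => (z - a) * h z) a = h a := by
  refine (((hasDerivAt_id a).sub_const a).mul hh.hasDerivAt).deriv.trans ?_
  simp

/-- If `g z = (z - a) ^ 2 * h z` near `a` with `h` analytic at `a`, then `g' a = 0` and
`g'' a = 2 * h a`. -/
lemma derivs_of_eventuallyEq_sq_mul {g h : ℂ → ℂ} {a : ℂ} (hh : AnalyticAt ℂ h a)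
    (hg : g =ᶠ[nhds a] fun z => (z - a) ^ 2 * h z) :
    deriv g a = 0 ∧ deriv (deriv g) a = 2 * h a := by
  have hd : deriv g =ᶠ[nhds a] fun z => (z - a) * (2 * h z + (z - a) * deriv h z) := by
    filter_upwards [hg.eventuallyEq_nhds, hh.eventually_analyticAt] with z hz hhz
    rw [hz.deriv_eq]
    refine ((((hasDerivAt_id z).sub_const a).pow 2).mul
      hhz.differentiableAt.hasDerivAt).deriv.trans ?_
    simp
    ring
  refine ⟨by simpa using hd.eq_of_nhds, ?_⟩
  have h1 := hh.differentiableAt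
  have h2 := hh.deriv.differentiableAt
  rw [hd.deriv_eq, deriv_sub_mul_self (by fun_prop)]
  simp

/-- For a polynomial `q` of degree at most `n` with `q(0) = 0`, the function
`g(z) = ((1+z)^(2n)/4^n) q(-((1-z)/(1+z))²)` satisfies `g'(1) = 0` and
`q'(0) = -2 g''(1)`. -/
theorem aux_polynomial_derivs_at_one (n : ℕ) (hn : 0 < n) (q : Polynomial ℂ)
    (hdeg : q.natDegree ≤ n) (h0 : q.eval 0 = 0)
    (g : ℂ → ℂ)
    (hg : ∀ z : ℂ, z ≠ -1 →
      g z = (1 + z) ^ (2 * n) / 4 ^ n * q.eval (-((1 - z) / (1 + z)) ^ 2)) :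
    deriv g 1 = 0 ∧ (Polynomial.derivative q).eval 0 = -2 * deriv (deriv g) 1 := by
  obtain ⟨r, rfl⟩ : X ∣ q := by
    rw [X_dvd_iff, coeff_zero_eq_eval_zero, h0]
  let h : ℂ → ℂ := fun z =>
    (1 + z) ^ (2 * n) / 4 ^ n * (-((1 + z)⁻¹ ^ 2) * r.eval (-((1 - z) / (1 + z)) ^ 2))
  have h2 : (1 : ℂ) + 1 ≠ 0 := by norm_num
  have hh : AnalyticAt ℂ h 1 := by
    have hw : AnalyticAt ℂ (fun z : ℂ => -((1 - z) / (1 + z)) ^ 2) 1 := by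
      fun_prop (disch := exact h2)
    have hr : AnalyticAt ℂ (fun z : ℂ => r.eval (-((1 - z) / (1 + z)) ^ 2)) 1 :=
      hw.aeval_polynomial r
    have hf : AnalyticAt ℂ (fun z : ℂ => (1 + z) ^ (2 * n) / 4 ^ n) 1 := by
      fun_prop (disch := simp)
    have hs : AnalyticAt ℂ (fun z : ℂ => -((1 + z)⁻¹ ^ 2)) 1 := by
      fun_prop (disch := exact h2)
    exact hf.mul (hs.mul hr)
  have hgh : g =ᶠ[nhds 1] fun z => (z - 1) ^ 2 * h z := by
    filter_upwards [isOpen_ne.mem_nhds (show (1 : ℂ) ≠ -1 by norm_num)] with z hz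
    rw [hg z hz, eval_mul, eval_X]
    simp only [h]
    ring
  obtain ⟨hd1, hd2⟩ := derivs_of_eventuallyEq_sq_mul hh hgh
  refine ⟨hd1, ?_⟩
  have h4 : ((1 : ℂ) + 1) ^ (2 * n) / 4 ^ n = 1 := by
    rw [pow_mul]
    norm_num
  rw [hd2]
  simp only [h, h4]
  norm_num
  ring
end

section
/- Let n be a positive integer and let pₙ : ℂ → ℂ be the polynomial determined by 2s·pₙ(s) = (1+s)ⁿ·(1 − Tₙ((1−s)/(1+s))) for s ≠ −1, and set qₙ(z) := z·pₙ(z). Then for every z ∈ ℂ with z ≠ 0 and z ≠ −1, ((1+z)^(2n)/(4z)ⁿ)·qₙ(−((1−z)/(1+z))²) = (2 − zⁿ − z⁻ⁿ)/4. -/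
open Polynomial

/-- The Joukowski form of the Chebyshev polynomials: `T n ((z + z⁻¹) / 2) = (zⁿ + z⁻ⁿ) / 2`. -/
theorem Polynomial.Chebyshev.T_eval_add_inv_div_two {K : Type*} [Field K] [NeZero (2 : K)]
    {z : K} (hz : z ≠ 0) (n : ℕ) :
    (Polynomial.Chebyshev.T K (n : ℤ)).eval ((z + z⁻¹) / 2) = (z ^ n + (z ^ n)⁻¹) / 2 := by
  have h2 : (2 : K) ≠ 0 := two_ne_zero
  induction n using Nat.twoStepInduction with
  | zero => simp [one_add_one_eq_two, h2]
  | one => simp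
  | more n h0 h1 =>
    push_cast at h1 ⊢
    rw [Polynomial.Chebyshev.T_add_two]
    simp only [eval_sub, eval_mul, eval_X, eval_ofNat, h0, h1]
    field_simp
    ring

/-- For the extremal polynomial `pₙ` (with `qₙ(z) = z pₙ(z)`), the auxiliary function
equals `(2 - zⁿ - z⁻ⁿ)/4` on the unit of definition:
`((1+z)^(2n)/(4z)ⁿ) qₙ(-((1-z)/(1+z))²) = (2 - zⁿ - z⁻ⁿ)/4` for `z ≠ 0, -1`. -/
theorem extremal_aux_function_eq (n : ℕ) (hn : 0 < n) (p : Polynomial ℂ)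
    (hp : ∀ s : ℂ, s ≠ -1 →
      2 * s * p.eval s =
        (1 + s) ^ n * (1 - (Polynomial.Chebyshev.T ℂ (n : ℤ)).eval ((1 - s) / (1 + s)))) :
    ∀ z : ℂ, z ≠ 0 → z ≠ -1 →
      (1 + z) ^ (2 * n) / (4 * z) ^ n *
        ((-((1 - z) / (1 + z)) ^ 2) * p.eval (-((1 - z) / (1 + z)) ^ 2)) =
      (2 - z ^ n - (z ^ n)⁻¹) / 4 := by
  intro z hz hz1
  have hz2 : 1 + z ≠ 0 := fun h => hz1 (by linear_combination h)
  have hs : 1 + -((1 - z) / (1 + z)) ^ 2 = 4 * z / (1 + z) ^ 2 := by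
    field_simp
    ring
  have hs0 : 4 * z / (1 + z) ^ 2 ≠ 0 := by simp [hz, hz2]
  have hr : (1 - -((1 - z) / (1 + z)) ^ 2) / (1 + -((1 - z) / (1 + z)) ^ 2) =
      (z + z⁻¹) / 2 := by
    rw [hs]
    field_simp
    ring
  have h := hp (-((1 - z) / (1 + z)) ^ 2) fun h => hs0 (by rw [← hs, h]; ring)
  rw [hr, hs, Polynomial.Chebyshev.T_eval_add_inv_div_two hz] at h
  have hc : (1 + z) ^ (2 * n) / (4 * z) ^ n * (4 * z / (1 + z) ^ 2) ^ n = 1 := by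
    rw [pow_mul, ← div_pow, ← mul_pow]
    field_simp
    simp
  linear_combination (1 + z) ^ (2 * n) / (4 * z) ^ n / 2 * h +
    (1 - (z ^ n + (z ^ n)⁻¹) / 2) / 2 * hc
end

section
/- Let n be an even positive integer and let pₙ : ℂ → ℂ be the polynomial determined by 2s·pₙ(s) = (1+s)ⁿ·(1 − Tₙ((1−s)/(1+s))) for s ≠ −1. Then pₙ has degree n − 2, every zero of pₙ is a positive real number, and every zero of pₙ has even multiplicity (each zero is a double zero). -/
open Polynomial

/-- Half-angle factorization of `1 - T` at an even index. -/
theorem one_sub_T_two_mul_eval (k : ℕ) (x : ℂ) :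
    1 - (Chebyshev.T ℂ (2 * ((k : ℤ) + 1))).eval x =
      2 * (1 - x ^ 2) * (Chebyshev.U ℂ k).eval x ^ 2 := by
  obtain ⟨θ, rfl⟩ := Complex.cos_surjective x
  have hU := Chebyshev.U_complex_cos θ k
  have hT := Chebyshev.T_complex_cos θ (2 * ((k : ℤ) + 1))
  have hcos : Complex.cos (((2 * ((k : ℤ) + 1) : ℤ) : ℂ) * θ) =
      2 * Complex.cos ((((k : ℤ) : ℂ) + 1) * θ) ^ 2 - 1 := by
    rw [← Complex.cos_two_mul]
    push_cast
    ring_nf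
  rw [hT, hcos]
  have h₁ := Complex.sin_sq_add_cos_sq θ
  have h₂ := Complex.sin_sq_add_cos_sq ((((k : ℤ) : ℂ) + 1) * θ)
  rw [← hU] at h₂
  linear_combination -2 * h₂ + 2 * (Chebyshev.U ℂ k).eval (Complex.cos θ) ^ 2 * h₁

/-- `U` splits over `ℂ` with simple roots, all in the real interval `(-1, 1)`. -/
theorem exists_U_eq_prod (k : ℕ) :
    ∃ S : Finset ℝ, S.card = k ∧ (∀ c ∈ S, -1 < c ∧ c < 1) ∧
      Chebyshev.U ℂ k = C (2 ^ k) * ∏ c ∈ S, (X - C (c : ℂ)) := by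
  set f : ℕ → ℝ := fun j => Real.cos ((j + 1) * Real.pi / (k + 1)) with hf
  have hroots : (Chebyshev.U ℝ k).roots = ((Finset.range k).image f).val :=
    Chebyshev.roots_U_real k
  have hcard : ((Finset.range k).image f).card = k := by
    have hnodup : ((Finset.range k).val.map f).Nodup := Chebyshev.roots_U_real_nodup k
    rw [Finset.card_image_of_injOn (Finset.nodup_map_iff_injOn.mp hnodup), Finset.card_range]
  refine ⟨(Finset.range k).image f, hcard, ?_, ?_⟩
  · intro c hc
    obtain ⟨j, hj, rfl⟩ := Finset.mem_image.mp hc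
    have hjk : (j : ℝ) + 1 < k + 1 := by
      have : (j : ℝ) < k := by exact_mod_cast Finset.mem_range.mp hj
      linarith
    have hpos : 0 < ((j : ℝ) + 1) * Real.pi / (k + 1) := by positivity
    have hlt : ((j : ℝ) + 1) * Real.pi / (k + 1) < Real.pi := by
      rw [div_lt_iff₀ (by positivity), mul_comm Real.pi]
      exact mul_lt_mul_of_pos_right hjk Real.pi_pos
    constructor
    · rw [← Real.cos_pi]
      exact Real.cos_lt_cos_of_nonneg_of_le_pi hpos.le le_rfl hlt
    · rw [← Real.cos_zero]
      exact Real.cos_lt_cos_of_nonneg_of_le_pi le_rfl hlt.le hpos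
  · have h := C_leadingCoeff_mul_prod_multiset_X_sub_C (p := Chebyshev.U ℝ k) (by
      rw [hroots, Chebyshev.natDegree_U_natCast]
      exact hcard)
    rw [hroots, Chebyshev.leadingCoeff_U_natCast] at h
    rw [← Chebyshev.map_U (algebraMap ℝ ℂ), ← h]
    change map _ (C (2 ^ k) * ∏ c ∈ (Finset.range k).image f, (X - C c)) = _
    simp [Polynomial.map_prod]

/-- The numerator of `U ((1 - s) / (1 + s))` has simple roots, all positive real. -/
theorem exists_one_add_pow_mul_U_eval_eq (k : ℕ) :
    ∃ (S : Finset ℂ) (K : ℂ), S.card = k ∧ K ≠ 0 ∧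
      (∀ z ∈ S, ∃ t : ℝ, 0 < t ∧ z = (t : ℂ)) ∧
      ∀ s : ℂ, s ≠ -1 →
        (1 + s) ^ k * (Chebyshev.U ℂ k).eval ((1 - s) / (1 + s)) = K * ∏ z ∈ S, (s - z) := by
  obtain ⟨S, hcard, hS, hU⟩ := exists_U_eq_prod k
  set g : ℝ → ℂ := fun c => (((1 - c) / (1 + c) : ℝ) : ℂ) with hg
  have hinj : Set.InjOn g S := by
    intro a ha b hb hab
    have ha' : 1 + a ≠ 0 := by linarith [(hS a ha).1]
    have hb' : 1 + b ≠ 0 := by linarith [(hS b hb).1]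
    have h : (1 - a) / (1 + a) = (1 - b) / (1 + b) := Complex.ofReal_injective hab
    rw [div_eq_div_iff ha' hb'] at h
    linarith
  have hne : ∀ c ∈ S, (1 + (c : ℂ)) ≠ 0 := by
    intro c hc h
    have : (1 + c : ℝ) = 0 := by exact_mod_cast h
    linarith [(hS c hc).1]
  refine ⟨S.image g, 2 ^ k * ∏ c ∈ S, (-(1 + (c : ℂ))), ?_, ?_, ?_, ?_⟩
  · rw [Finset.card_image_of_injOn hinj, hcard]
  · exact mul_ne_zero (pow_ne_zero _ two_ne_zero) (Finset.prod_ne_zero_iff.mpr fun c hc =>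
      neg_ne_zero.mpr (hne c hc))
  · intro z hz
    obtain ⟨c, hc, rfl⟩ := Finset.mem_image.mp hz
    exact ⟨_, div_pos (by linarith [(hS c hc).2]) (by linarith [(hS c hc).1]), rfl⟩
  · intro s hs
    have hs' : 1 + s ≠ 0 := fun h => hs (by linear_combination h)
    rw [hU, Finset.prod_image hinj, mul_assoc, ← Finset.prod_mul_distrib]
    simp only [eval_mul, eval_C, eval_prod, eval_sub, eval_X]
    rw [mul_left_comm]
    congr 1
    conv_lhs => rw [← hcard, ← Finset.prod_const, ← Finset.prod_mul_distrib]
    refine Finset.prod_congr rfl fun c hc => ?_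
    have := hne c hc
    simp only [hg]
    push_cast
    field_simp
    ring

/-- For even `n`, the extremal polynomial `pₙ` has degree `n - 2`, and all its zeros
are positive real numbers which are double zeros. -/
theorem extremal_polynomial_roots (n : ℕ) (hn : 0 < n) (heven : Even n) (p : Polynomial ℂ)
    (hp : ∀ s : ℂ, s ≠ -1 →
      2 * s * p.eval s =
        (1 + s) ^ n * (1 - (Polynomial.Chebyshev.T ℂ (n : ℤ)).eval ((1 - s) / (1 + s)))) :
    p.natDegree = n - 2 ∧
    ∀ z : ℂ, p.IsRoot z →
      (∃ t : ℝ, 0 < t ∧ z = (t : ℂ)) ∧ p.rootMultiplicity z = 2 := by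
  obtain ⟨k, rfl⟩ : ∃ k, n = 2 * (k + 1) := by
    obtain ⟨m, rfl⟩ := heven
    exact ⟨m - 1, by omega⟩
  obtain ⟨S, K, hcard, hK, hS, hprod⟩ := exists_one_add_pow_mul_U_eval_eq k
  have hK' : 4 * K ^ 2 ≠ 0 := mul_ne_zero (by norm_num) (pow_ne_zero _ hK)
  have hpeq : p = C (4 * K ^ 2) * (∏ z ∈ S, (X - C z)) ^ 2 := by
    refine eq_of_infinite_eval_eq _ _ ((Set.toFinite {0, -1}).infinite_compl.mono ?_)
    intro s hs
    simp only [Set.mem_compl_iff, Set.mem_insert_iff, Set.mem_singleton_iff, not_or] at hs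
    obtain ⟨hs₀, hs₁⟩ := hs
    have hs' : 1 + s ≠ 0 := fun h => hs₁ (by linear_combination h)
    have h := hp s hs₁
    push_cast at h
    rw [one_sub_T_two_mul_eval] at h
    have hsq : (1 + s) ^ 2 * (1 - ((1 - s) / (1 + s)) ^ 2) = 4 * s := by
      field_simp
      ring
    simp only [Set.mem_ofPred_eq, eval_mul, eval_C, eval_pow, eval_prod, eval_sub, eval_X]
    apply mul_left_cancel₀ (mul_ne_zero two_ne_zero hs₀)
    rw [h, mul_assoc 4, ← mul_pow, ← hprod s hs₁]
    linear_combination 2 * ((1 + s) ^ k * (Chebyshev.U ℂ k).eval ((1 - s) / (1 + s))) ^ 2 * hsq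
  have hroots : p.roots = 2 • S.val := by
    rw [hpeq, roots_C_mul _ hK', roots_pow, roots_prod_X_sub_C]
  constructor
  · rw [hpeq, natDegree_C_mul hK', natDegree_pow, natDegree_finsetProd_X_sub_C_eq_card, hcard]
    omega
  · intro z hz
    have hp₀ : p ≠ 0 := by
      rw [hpeq]
      exact mul_ne_zero (C_ne_zero.mpr hK')
        (pow_ne_zero _ (Finset.prod_ne_zero_iff.mpr fun z _ => X_sub_C_ne_zero z))
    have hzS : z ∈ S := by
      have h := (mem_roots hp₀).mpr hz
      rw [hroots] at h
      exact Multiset.mem_of_mem_nsmul h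
    refine ⟨hS z hzS, ?_⟩
    rw [← count_roots, hroots, Multiset.count_nsmul,
      Multiset.count_eq_one_of_mem S.nodup hzS]
end
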